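/- (Gronwall-type inequality from s = 0) Let E > 0 and 0 ≤ θ < 1, and let c be a frequency envelope of energy at most E. Let f, g : (0,∞) → [0,∞) be locally integrable functions such that f(s) → 0 as s → 0, g satisfies g(s′) ≤ max((s′/s)^{δ₀},(s/s′)^{δ₀}) g(s) for all s, s′ > 0, and f(s) ≤ g(s) + ∫₀^s f(s′) c(s′) ((s−s′)/s)^{−θ} (s′/s)^{3δ₀} ds′/s′ for all s > 0. Then f(s) ≤ C g(s) for all s > 0, where C depends only on E, θ, and δ₀. -/

import Mathlib

open MeasureTheory

/-- A frequency envelope of energy at most `E`. -/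
def IsFreqEnvelopeLE (δ₀ E : ℝ) (c : ℝ → ℝ) : Prop :=
  (∀ s : ℝ, 0 < s → 0 ≤ c s) ∧
  IntegrableOn (fun s => (c s) ^ 2 / s) (Set.Ioi 0) volume ∧
  (∫ s in Set.Ioi (0 : ℝ), (c s) ^ 2 / s) ≤ E ∧
  (∀ s : ℝ, 0 < s → ∀ s' : ℝ, 0 < s' →
    c s' ≤ max ((s' / s) ^ δ₀) ((s / s') ^ δ₀) * c s)


lemma rpow_int (r s : ℝ) (hr : -1 < r) (hs : 0 < s) :
    ∫⁻ x in Set.Ioo 0 s, ENNReal.ofReal (x ^ r) = ENNReal.ofReal (s ^ (r+1) / (r+1)) := by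
  have h1 : IntegrableOn (fun x : ℝ => x ^ r) (Set.Ioo 0 s) := by
    have := intervalIntegral.intervalIntegrable_rpow' (a := 0) (b := s) hr
    rw [intervalIntegrable_iff_integrableOn_Ioo_of_le hs.le] at this
    exact this
  rw [← ofReal_integral_eq_lintegral_ofReal h1]
  · congr 1
    rw [← integral_Ioc_eq_integral_Ioo, ← intervalIntegral.integral_of_le hs.le,
      integral_rpow (Or.inl hr), Real.zero_rpow (by linarith)]
    simp
  · filter_upwards [ae_restrict_mem measurableSet_Ioo] with x hx
    exact Real.rpow_nonneg hx.1.le _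

lemma rpow_int' (r s : ℝ) (hr : -1 < r) (hs : 0 < s) :
    ∫⁻ x in Set.Ioo 0 s, ENNReal.ofReal ((s - x) ^ r) = ENNReal.ofReal (s ^ (r+1) / (r+1)) := by
  have h1 : IntegrableOn (fun x : ℝ => (s - x) ^ r) (Set.Ioo 0 s) := by
    have := (intervalIntegral.intervalIntegrable_rpow' (a := 0) (b := s) hr).comp_sub_left s
    simp only [sub_zero, sub_self] at this
    replace this := this.symm
    rw [intervalIntegrable_iff_integrableOn_Ioo_of_le hs.le] at this
    exact this
  rw [← ofReal_integral_eq_lintegral_ofReal h1]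
  · congr 1
    rw [← integral_Ioc_eq_integral_Ioo, ← intervalIntegral.integral_of_le hs.le,
      intervalIntegral.integral_comp_sub_left (fun x => x ^ r),
      integral_rpow (Or.inl (by simpa using hr)), sub_self, Real.zero_rpow (by linarith)]
    simp
  · filter_upwards [ae_restrict_mem measurableSet_Ioo] with x hx
    exact Real.rpow_nonneg (by linarith [hx.2]) _

lemma kernel_int (a b s : ℝ) (ha0 : 0 ≤ a) (ha : a < 1) (hb : 0 < b) (hs : 0 < s) :
    ∫⁻ x in Set.Ioo 0 s, ENNReal.ofReal (x⁻¹ * ((s - x) / s) ^ (-a) * (x / s) ^ b) ≤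
      ENNReal.ofReal (2 / (1 - a) + 2 / b) := by
  have hp : ∀ x ∈ Set.Ioo 0 s, ENNReal.ofReal (x⁻¹ * ((s - x) / s) ^ (-a) * (x / s) ^ b) ≤
      ENNReal.ofReal (2 * s ^ (a - 1)) * ENNReal.ofReal ((s - x) ^ (-a)) +
      ENNReal.ofReal (2 * s ^ (-b)) * ENNReal.ofReal (x ^ (b - 1)) := by
    intro x hx
    obtain ⟨hx0, hxs⟩ := hx
    have hy : 0 < s - x := by linarith
    rw [← ENNReal.ofReal_mul (by positivity), ← ENNReal.ofReal_mul (by positivity),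
      ← ENNReal.ofReal_add (by positivity) (by positivity)]
    apply ENNReal.ofReal_le_ofReal
    have e1 : 2 * s ^ (a - 1) * (s - x) ^ (-a) = 2 * (s⁻¹ * ((s - x) / s) ^ (-a)) := by
      rw [Real.div_rpow hy.le hs.le, Real.rpow_sub hs, Real.rpow_neg hs.le, Real.rpow_one]
      field_simp
    have e2 : 2 * s ^ (-b) * x ^ (b - 1) = 2 * (x⁻¹ * (x / s) ^ b) := by
      rw [Real.div_rpow hx0.le hs.le, Real.rpow_sub hx0, Real.rpow_neg hs.le, Real.rpow_one]
      field_simp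
    rw [e1, e2]
    by_cases hc : x ≤ s / 2
    · have : ((s - x) / s) ^ (-a) ≤ 2 := by
        have h2 : (1/2 : ℝ) ≤ (s - x) / s := by rw [le_div_iff₀ hs]; linarith
        calc ((s - x) / s) ^ (-a) ≤ (1/2 : ℝ) ^ (-a) :=
              Real.rpow_le_rpow_of_nonpos (by norm_num) h2 (by linarith)
          _ ≤ (1/2 : ℝ) ^ (-1 : ℝ) :=
              Real.rpow_le_rpow_of_exponent_ge (by norm_num) (by norm_num) (by linarith)
          _ = 2 := by rw [Real.rpow_neg_one]; norm_num
      have h3 : 0 ≤ 2 * (s⁻¹ * ((s - x) / s) ^ (-a)) := by positivity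
      have h4 : 0 ≤ x⁻¹ * (x / s) ^ b := by positivity
      nlinarith
    · push Not at hc
      have h5 : x⁻¹ * (x / s) ^ b ≤ 2 * s⁻¹ := by
        have h6 : (x / s) ^ b ≤ 1 := Real.rpow_le_one (by positivity)
          (by rw [div_le_one hs]; exact hxs.le) hb.le
        have h7 : x⁻¹ ≤ 2 * s⁻¹ := by
          rw [inv_le_iff_one_le_mul₀ hx0]
          field_simp
          linarith
        calc x⁻¹ * (x / s) ^ b ≤ x⁻¹ * 1 := by gcongr
          _ ≤ _ := by linarith
      have h3 : 0 ≤ ((s - x) / s) ^ (-a) := by positivity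
      have h4 : 0 ≤ x⁻¹ * (x / s) ^ b := by positivity
      nlinarith
  refine (setLIntegral_mono' measurableSet_Ioo hp).trans ?_
  rw [lintegral_add_left (by fun_prop), lintegral_const_mul _ (by fun_prop),
    lintegral_const_mul _ (by fun_prop), rpow_int _ _ (by linarith) hs, rpow_int' _ _ (by linarith) hs,
    ← ENNReal.ofReal_mul (by positivity), ← ENNReal.ofReal_mul (by positivity)]
  have i1 : 0 < 1 - a := by linarith
  have i2 : -a + 1 = 1 - a := by ring
  have i3 : b - 1 + 1 = b := by ring
  rw [i2, i3, ← ENNReal.ofReal_add (by positivity) (by positivity)]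
  apply ENNReal.ofReal_le_ofReal
  apply le_of_eq
  have j1 : s ^ (a - 1) * s ^ (1 - a) = 1 := by rw [← Real.rpow_add hs]; simp
  have j2 : s ^ (-b) * s ^ b = 1 := by rw [← Real.rpow_add hs]; simp
  calc _ = 2 * (s ^ (a - 1) * s ^ (1 - a)) / (1 - a) + 2 * (s ^ (-b) * s ^ b) / b := by ring
    _ = _ := by rw [j1, j2]; ring

/-- L¹ contraction. -/
lemma l1_zero (H r : ℝ → ENNReal) (hH : AEMeasurable H) (hr : Measurable r)
    (hr1 : ∫⁻ t, r t ≤ 1 / 2) (hfin : ∫⁻ t, H t ≠ ⊤)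
    (hle : ∀ s, H s ≤ ∫⁻ t, r (s - t) * H t) : H =ᵐ[volume] 0 := by
  have h1 : ∫⁻ s, H s ≤ 1 / 2 * ∫⁻ t, H t := by
    calc ∫⁻ s, H s ≤ ∫⁻ s, ∫⁻ t, r (s - t) * H t := lintegral_mono hle
      _ = ∫⁻ t, ∫⁻ s, r (s - t) * H t := by
        apply lintegral_lintegral_swap
        apply AEMeasurable.mul
        · exact (hr.comp (measurable_fst.sub measurable_snd)).aemeasurable
        · exact hH.comp_snd
      _ = ∫⁻ t, (∫⁻ s, r s) * H t := by
        congr 1; ext t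
        rw [lintegral_mul_const _ (by fun_prop), lintegral_sub_right_eq_self r]
      _ ≤ ∫⁻ t, 1 / 2 * H t := by gcongr
      _ = _ := lintegral_const_mul'' _ hH
  rw [← lintegral_eq_zero_iff' hH]
  by_contra hne
  have := ENNReal.half_lt_self hne hfin
  rw [one_div, mul_comm, ← div_eq_mul_inv] at h1
  exact absurd h1 (not_le.mpr this)

lemma exp_kernel (A θ : ℝ) (hA : 0 < A) (hθ1 : θ < 1) :
    ∃ β : ℝ, 0 < β ∧ ∫⁻ t in Set.Ioi 0, ENNReal.ofReal (A * t ^ (-θ) * Real.exp (-(β * t))) ≤ 1/2 := by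
  have hG : 0 < Real.Gamma (1 - θ) := Real.Gamma_pos_of_pos (by linarith)
  set D := 2 * A * Real.Gamma (1 - θ) with hD
  have hDp : 0 < D := by positivity
  have i1 : 0 < 1 - θ := by linarith
  refine ⟨D ^ (1 / (1 - θ)), by positivity, ?_⟩
  set β := D ^ (1 / (1 - θ)) with hβ
  have hβp : 0 < β := by positivity
  have hint : ∫ t in Set.Ioi 0, t ^ (-θ) * Real.exp (-(β * t)) = (1/β) ^ (1-θ) * Real.Gamma (1-θ) := by
    rw [← Real.integral_rpow_mul_exp_neg_mul_Ioi i1 hβp]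
    congr 1; ext t; congr 2; ring
  have hne : IntegrableOn (fun t : ℝ => t ^ (-θ) * Real.exp (-(β * t))) (Set.Ioi 0) := by
    by_contra hcon
    have := integral_undef hcon
    rw [this] at hint
    have : 0 < (1/β) ^ (1-θ) * Real.Gamma (1-θ) := by positivity
    linarith
  have e : ∀ t : ℝ, A * t ^ (-θ) * Real.exp (-(β * t)) = A * (t ^ (-θ) * Real.exp (-(β * t))) :=
    fun t => by ring
  simp_rw [e]
  rw [← ofReal_integral_eq_lintegral_ofReal (hne.const_mul A)]
  · rw [integral_const_mul, hint, Real.div_rpow (by norm_num) hβp.le, hβ, ← Real.rpow_mul hDp.le,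
      one_div_mul_cancel i1.ne', Real.one_rpow, Real.rpow_one]
    rw [show A * (1 / D * Real.Gamma (1 - θ)) = 1/2 by rw [hD]; field_simp]
    rw [ENNReal.ofReal_div_of_pos (by norm_num)]; simp
  · filter_upwards [ae_restrict_mem measurableSet_Ioi] with x hx
    have : (0:ℝ) < x := hx
    simp only [Pi.zero_apply]; positivity

lemma env_cont (δ : ℝ) (c : ℝ → ℝ)
    (hc : ∀ s : ℝ, 0 < s → ∀ s' : ℝ, 0 < s' → c s' ≤ max ((s' / s) ^ δ) ((s / s') ^ δ) * c s) :
    ContinuousOn c (Set.Ioi 0) := by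
  intro s hs
  have hs : 0 < s := hs
  apply ContinuousAt.continuousWithinAt
  have hm : ContinuousAt (fun s' : ℝ => max ((s' / s) ^ δ) ((s / s') ^ δ)) s := by
    apply ContinuousAt.sup
    · apply ContinuousAt.rpow_const
      · fun_prop
      · left; positivity
    · apply ContinuousAt.rpow_const
      · exact continuousAt_const.div continuousAt_id hs.ne'
      · left; positivity
  have hm1 : max ((s / s) ^ δ) ((s / s) ^ δ) = 1 := by
    rw [max_self, div_self hs.ne', Real.one_rpow]
  have hpos : ∀ᶠ s' in nhds s, 0 < s' := eventually_gt_nhds hs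
  have hub : Filter.Tendsto (fun s' : ℝ => max ((s' / s) ^ δ) ((s / s') ^ δ) * c s) (nhds s)
      (nhds (c s)) := by
    have := hm.tendsto.mul_const (c s)
    rwa [hm1, one_mul] at this
  have hlb : Filter.Tendsto (fun s' : ℝ => c s / max ((s' / s) ^ δ) ((s / s') ^ δ)) (nhds s)
      (nhds (c s)) := by
    have := (tendsto_const_nhds (x := c s)).div hm.tendsto (by rw [hm1]; norm_num)
    rwa [hm1, div_one] at this
  refine tendsto_of_tendsto_of_tendsto_of_le_of_le' hlb hub ?_ ?_
  · filter_upwards [hpos] with s' hs'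
    have hmp : 0 < max ((s' / s) ^ δ) ((s / s') ^ δ) := lt_max_of_lt_left (by positivity)
    rw [div_le_iff₀ hmp, mul_comm, max_comm]
    exact hc s' hs' s hs
  · filter_upwards [hpos] with s' hs'
    exact hc s hs s' hs'

lemma env_bound (δ E : ℝ) (hδ : 0 < δ) (hδ' : δ ≤ 1 / 100) (c : ℝ → ℝ)
    (h : IsFreqEnvelopeLE δ E c) (s : ℝ) (hs : 0 < s) : c s ≤ 2 * Real.sqrt E := by
  obtain ⟨hc0, hint, hE, hc⟩ := h
  have hsub : Set.Ioc s (2 * s) ⊆ Set.Ioi 0 := fun x hx => lt_trans hs hx.1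
  have hnn : 0 ≤ᵐ[volume.restrict (Set.Ioi (0:ℝ))] fun s => c s ^ 2 / s := by
    filter_upwards [ae_restrict_mem measurableSet_Ioi] with x hx
    have : (0:ℝ) < x := hx
    simp only [Pi.zero_apply]; positivity
  have h1 : ∫ x in Set.Ioc s (2 * s), c x ^ 2 / x ≤ E :=
    (setIntegral_mono_set hint hnn hsub.eventuallyLE).trans hE
  have h2 : ∫ x in Set.Ioc s (2 * s), c s ^ 2 / (4 * s) ≤ ∫ x in Set.Ioc s (2 * s), c x ^ 2 / x := by
    apply setIntegral_mono_on
    · simp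
    · exact hint.mono_set hsub
    · exact measurableSet_Ioc
    · intro x hx
      have hx0 : 0 < x := hsub hx
      have h3 := hc x hx0 s hs
      have h4 : max ((s / x) ^ δ) ((x / s) ^ δ) ≤ Real.sqrt 2 := by
        apply max_le
        · refine (Real.rpow_le_one (by positivity) ?_ hδ.le).trans ?_
          · rw [div_le_one hx0]; exact hx.1.le
          · rw [Real.one_le_sqrt]; norm_num
        · rw [Real.sqrt_eq_rpow]
          calc (x / s) ^ δ ≤ 2 ^ δ := by
                apply Real.rpow_le_rpow (by positivity) _ hδ.le
                rw [div_le_iff₀ hs]; exact hx.2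
            _ ≤ _ := Real.rpow_le_rpow_of_exponent_le (by norm_num) (by linarith)
      have h5 : c s ≤ Real.sqrt 2 * c x := h3.trans (mul_le_mul_of_nonneg_right h4 (hc0 x hx0))
      have h6 : c s ^ 2 ≤ 2 * c x ^ 2 := by
        calc c s ^ 2 ≤ (Real.sqrt 2 * c x) ^ 2 := by
              have := hc0 s hs
              gcongr
          _ = _ := by rw [mul_pow, Real.sq_sqrt (by norm_num)]
      rw [div_le_div_iff₀ (by positivity) hx0]
      calc c s ^ 2 * x ≤ (2 * c x ^ 2) * (2 * s) :=
            mul_le_mul h6 hx.2 hx0.le (by positivity)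
        _ = _ := by ring
  rw [setIntegral_const] at h2
  simp only [Real.volume_real_Ioc, smul_eq_mul] at h2
  rw [max_eq_left (by linarith)] at h2
  have h7 : (2 * s - s) * (c s ^ 2 / (4 * s)) = c s ^ 2 / 4 := by field_simp; ring
  rw [h7] at h2
  have h8 : c s ^ 2 ≤ 4 * E := by linarith
  have h9 : 2 * Real.sqrt E = Real.sqrt (4 * E) := by
    rw [Real.sqrt_mul (by norm_num), show (4:ℝ) = 2 ^ 2 by norm_num, Real.sqrt_sq (by norm_num)]
  rw [h9]
  exact Real.le_sqrt_of_sq_le h8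

/-- primitive of the energy density -/
lemma env_phi (δ E : ℝ) (c : ℝ → ℝ) (h : IsFreqEnvelopeLE δ E c) :
    ∃ φ : ℝ → ℝ, ContinuousOn φ (Set.Ioi 0) ∧ (∀ s, 0 < s → 0 ≤ φ s ∧ φ s ≤ E) ∧
      ∀ μ : ℝ, 0 < μ → ∀ s : ℝ, 0 < s →
        ∫⁻ x in Set.Ioo 0 s, ENNReal.ofReal (c x ^ 2 / x * Real.exp (-(μ * (φ s - φ x)))) ≤
          ENNReal.ofReal (1 / μ) := by
  have hcont := env_cont δ c h.2.2.2
  obtain ⟨hc0, hint, hE, hc⟩ := h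
  have hwc : ContinuousOn (fun x => c x ^ 2 / x) (Set.Ioi 0) :=
    (hcont.pow 2).div continuousOn_id (fun x hx => ne_of_gt hx)
  have hii : ∀ s, 0 < s → IntervalIntegrable (fun x => c x ^ 2 / x) volume 0 s := fun s hs => by
    rw [intervalIntegrable_iff_integrableOn_Ioc_of_le hs.le]
    exact hint.mono_set (fun x hx => hx.1)
  have hd : ∀ s, 0 < s → HasDerivAt (fun u => ∫ x in (0:ℝ)..u, c x ^ 2 / x) (c s ^ 2 / s) s := by
    intro s hs
    apply intervalIntegral.integral_hasDerivAt_right (hii s hs)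
    · exact hwc.stronglyMeasurableAtFilter isOpen_Ioi s hs
    · exact hwc.continuousAt (Ioi_mem_nhds hs)
  have hnn : 0 ≤ᵐ[volume.restrict (Set.Ioi (0:ℝ))] fun s => c s ^ 2 / s := by
    filter_upwards [ae_restrict_mem measurableSet_Ioi] with x hx
    have : (0:ℝ) < x := hx
    simp only [Pi.zero_apply]; positivity
  refine ⟨fun u => ∫ x in (0:ℝ)..u, c x ^ 2 / x, ?_, ?_, ?_⟩
  · intro s hs
    exact (hd s hs).continuousAt.continuousWithinAt
  · intro s hs
    constructor
    · apply intervalIntegral.integral_nonneg hs.le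
      intro x hx
      have := hx.1
      positivity
    · refine le_trans ?_ hE
      beta_reduce
      rw [intervalIntegral.integral_of_le hs.le]
      exact setIntegral_mono_set hint hnn (LE.le.eventuallyLE fun x hx => hx.1)
  · intro μ hμ s hs
    set φ : ℝ → ℝ := fun u => ∫ x in (0:ℝ)..u, c x ^ 2 / x with hφ
    have hφc : ContinuousOn φ (Set.Icc 0 s) := by
      have := intervalIntegral.continuousOn_primitive_interval (μ := volume) (a := 0) (b := s)
        (f := fun x => c x ^ 2 / x) (by
          rw [Set.uIcc_of_le hs.le, integrableOn_Icc_iff_integrableOn_Ioc]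
          exact hint.mono_set (fun x hx => hx.1))
      rwa [Set.uIcc_of_le hs.le] at this
    have hec : ContinuousOn (fun x => Real.exp (-(μ * (φ s - φ x)))) (Set.Icc 0 s) := by
      fun_prop
    have hI : IntervalIntegrable (fun x => c x ^ 2 / x * Real.exp (-(μ * (φ s - φ x)))) volume 0 s := by
      apply (hii s hs).mul_continuousOn
      rwa [Set.uIcc_of_le hs.le]
    have hF := intervalIntegral.integral_eq_sub_of_hasDerivAt_of_le hs.le
      (f := fun x => Real.exp (-(μ * (φ s - φ x))) / μ)
      (f' := fun x => c x ^ 2 / x * Real.exp (-(μ * (φ s - φ x)))) (hec.div_const μ)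
      (by
        intro x hx
        have h1 : HasDerivAt φ (c x ^ 2 / x) x := hd x hx.1
        have h2 := ((((h1.const_sub (φ s)).const_mul μ).neg).exp).div_const μ
        refine h2.congr_deriv ?_
        rw [div_eq_iff hμ.ne']
        simp only [Pi.neg_apply]
        ring) hI
    rw [← ofReal_integral_eq_lintegral_ofReal]
    · apply ENNReal.ofReal_le_ofReal
      rw [← integral_Ioc_eq_integral_Ioo, ← intervalIntegral.integral_of_le hs.le, hF]
      have : 0 < Real.exp (-(μ * (φ s - φ 0))) / μ := by positivity
      simp only [sub_self, mul_zero, neg_zero, Real.exp_zero]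
      linarith
    · rw [intervalIntegrable_iff_integrableOn_Ioo_of_le hs.le] at hI
      exact hI
    · filter_upwards [ae_restrict_mem measurableSet_Ioo] with x hx
      have := hx.1
      simp only [Pi.zero_apply]; positivity

lemma key (δ E θ : ℝ) (hδ : 0 < δ) (hδ' : δ ≤ 1 / 100) (hE : 0 < E) (hθ₀ : 0 ≤ θ) (hθ₁ : θ < 1) :
    ∃ L : ℝ, 0 < L ∧ ∀ c : ℝ → ℝ, IsFreqEnvelopeLE δ E c → ∃ φ : ℝ → ℝ,
      ContinuousOn φ (Set.Ioi 0) ∧ (∀ s, 0 < s → 0 ≤ φ s ∧ φ s ≤ E) ∧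
      ∀ s : ℝ, 0 < s → ∫⁻ x in Set.Ioo 0 s, ENNReal.ofReal
        (c x * (s / x) ^ δ * (((s - x) / s) ^ (-θ) * (x / s) ^ (3 * δ) / x) * Real.exp (L * φ x)) ≤
        ENNReal.ofReal (1 / 2 * Real.exp (L * φ s)) := by
  set p : ℝ := 2 / (1 - θ) with hp
  set q : ℝ := 2 / (1 + θ) with hq
  have i1 : 0 < 1 - θ := by linarith
  have hp0 : 0 < p := by positivity
  have hq0 : 0 < q := by positivity
  have hpi : 1 / p = (1 - θ) / 2 := by rw [hp]; field_simp
  have hqi : 1 / q = (1 + θ) / 2 := by rw [hq]; field_simp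
  have hpq : p.HolderConjugate q := by
    rw [Real.holderConjugate_iff]
    constructor
    · rw [hp, lt_div_iff₀ i1]; linarith
    · rw [← one_div, ← one_div, hpi, hqi]; ring
  have ha : θ * q < 1 := by
    rw [hq, ← mul_div_assoc, div_lt_one (by linarith)]; linarith
  have ha0 : 0 ≤ θ * q := by positivity
  have hb : 0 < 2 * δ * q := by positivity
  set N : ℝ := 2 / (1 - θ * q) + 2 / (2 * δ * q) with hN
  have hNp : 0 < N := by
    have : 0 < 1 - θ * q := by linarith
    positivity
  set M : ℝ := 2 * Real.sqrt E with hM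
  have hMp : 0 < M := by
    have := Real.sqrt_pos.mpr hE
    positivity
  set D : ℝ := M ^ θ * N ^ (1 / q) with hD
  have hDp : 0 < D := by positivity
  set μ : ℝ := (2 * D) ^ p with hμ
  have hμp : 0 < μ := by positivity
  refine ⟨μ / p, by positivity, ?_⟩
  set L := μ / p with hL
  intro c hc
  obtain ⟨φ, hφc, hφb, hφi⟩ := env_phi δ E c hc
  refine ⟨φ, hφc, hφb, ?_⟩
  have hcc := env_cont δ c hc.2.2.2
  intro s hs
  set F : ℝ → ENNReal := fun x => ENNReal.ofReal ((c x ^ 2 / x) ^ (1 / p) * Real.exp (-(L * (φ s - φ x))))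
    with hF
  set G : ℝ → ENNReal := fun x => ENNReal.ofReal ((x⁻¹) ^ (1 / q) * ((s - x) / s) ^ (-θ) * (x / s) ^ (2 * δ))
    with hG
  have hsub : Set.Ioo 0 s ⊆ Set.Ioi 0 := fun x hx => hx.1
  have hcm : AEMeasurable c (volume.restrict (Set.Ioo 0 s)) :=
    (hcc.mono hsub).aemeasurable measurableSet_Ioo
  have hφm : AEMeasurable φ (volume.restrict (Set.Ioo 0 s)) :=
    (hφc.mono hsub).aemeasurable measurableSet_Ioo
  have hFm : AEMeasurable F (volume.restrict (Set.Ioo 0 s)) := by fun_prop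
  have hGm : AEMeasurable G (volume.restrict (Set.Ioo 0 s)) := by fun_prop
  have hH := ENNReal.lintegral_mul_le_Lp_mul_Lq (volume.restrict (Set.Ioo 0 s)) hpq hFm hGm
  have hFi : ∫⁻ x in Set.Ioo 0 s, F x ^ p ≤ ENNReal.ofReal (1 / μ) := by
    refine le_trans (le_of_eq ?_) (hφi μ hμp s hs)
    apply setLIntegral_congr_fun measurableSet_Ioo
    intro x hx
    have hx0 := hx.1
    simp only [hF]
    rw [ENNReal.ofReal_rpow_of_nonneg (by positivity) hp0.le,
      Real.mul_rpow (by positivity) (by positivity), ← Real.rpow_mul (by positivity),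
      one_div_mul_cancel hp0.ne', Real.rpow_one, ← Real.exp_mul]
    congr 3
    rw [hL]; field_simp
  have hGi : ∫⁻ x in Set.Ioo 0 s, G x ^ q ≤ ENNReal.ofReal N := by
    refine le_trans (le_of_eq ?_) (kernel_int (θ * q) (2 * δ * q) s ha0 ha hb hs)
    apply setLIntegral_congr_fun measurableSet_Ioo
    intro x hx
    have hx0 := hx.1
    have hx1 : 0 < s - x := by linarith [hx.2]
    simp only [hG]
    rw [ENNReal.ofReal_rpow_of_nonneg (by positivity) hq0.le,
      Real.mul_rpow (by positivity) (by positivity), Real.mul_rpow (by positivity) (by positivity),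
      ← Real.rpow_mul (by positivity), ← Real.rpow_mul (by positivity),
      ← Real.rpow_mul (by positivity),
      one_div_mul_cancel hq0.ne', Real.rpow_one, neg_mul]
  have hpt : ∀ x ∈ Set.Ioo 0 s, ENNReal.ofReal
        (c x * (s / x) ^ δ * (((s - x) / s) ^ (-θ) * (x / s) ^ (3 * δ) / x) * Real.exp (L * φ x)) ≤
      ENNReal.ofReal (M ^ θ * Real.exp (L * φ s)) * (F * G) x := by
    intro x hx
    have hx0 := hx.1
    have hx1 : 0 < s - x := by linarith [hx.2]
    simp only [hF, hG, Pi.mul_apply]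
    rw [← ENNReal.ofReal_mul (by positivity), ← ENNReal.ofReal_mul (by positivity)]
    apply ENNReal.ofReal_le_ofReal
    have hcx := hc.1 x hx0
    have e1 : c x ≤ M ^ θ * (c x ^ 2) ^ (1 / p) := by
      have : (c x ^ 2) ^ (1 / p) = c x ^ (1 - θ) := by
        rw [hpi, ← Real.rpow_natCast, ← Real.rpow_mul hcx]; congr 1; push_cast; ring
      rw [this]
      calc c x = c x ^ θ * c x ^ (1 - θ) := by
            rw [← Real.rpow_add_of_nonneg hcx hθ₀ i1.le]; simp
        _ ≤ _ := by
            gcongr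
            exact env_bound δ E hδ hδ' c hc x hx0
    have e2 : (s / x) ^ δ * (x / s) ^ (3 * δ) = (x / s) ^ (2 * δ) := by
      rw [← inv_div, Real.inv_rpow (by positivity), ← Real.rpow_neg (by positivity),
        ← Real.rpow_add (by positivity)]
      congr 1; ring
    have e3 : Real.exp (L * φ x) = Real.exp (L * φ s) * Real.exp (-(L * (φ s - φ x))) := by
      rw [← Real.exp_add]; congr 1; ring
    have e4 : x⁻¹ = (x⁻¹) ^ (1 / p) * (x⁻¹) ^ (1 / q) := by
      rw [← Real.rpow_add (by positivity), hpi, hqi,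
        show (1 - θ) / 2 + (1 + θ) / 2 = 1 by ring, Real.rpow_one]
    have e5 : (c x ^ 2 / x) ^ (1 / p) = (c x ^ 2) ^ (1 / p) * (x⁻¹) ^ (1 / p) := by
      rw [div_eq_mul_inv, Real.mul_rpow (by positivity) (by positivity)]
    calc _ = c x * (((s - x) / s) ^ (-θ) * ((s / x) ^ δ * (x / s) ^ (3 * δ)) * x⁻¹ *
              Real.exp (L * φ x)) := by ring
      _ ≤ (M ^ θ * (c x ^ 2) ^ (1 / p)) * (((s - x) / s) ^ (-θ) * ((s / x) ^ δ * (x / s) ^ (3 * δ)) * x⁻¹ *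
              Real.exp (L * φ x)) := by
            apply mul_le_mul_of_nonneg_right e1; positivity
      _ = (M ^ θ * (c x ^ 2) ^ (1 / p)) * (((s - x) / s) ^ (-θ) * (x / s) ^ (2 * δ) *
            ((x⁻¹) ^ (1 / p) * (x⁻¹) ^ (1 / q)) *
            (Real.exp (L * φ s) * Real.exp (-(L * (φ s - φ x))))) := by
            rw [e2, e3, ← e4]
      _ = _ := by rw [e5]; ring
  calc _ ≤ ∫⁻ x in Set.Ioo 0 s, ENNReal.ofReal (M ^ θ * Real.exp (L * φ s)) * (F * G) x :=
        setLIntegral_mono' measurableSet_Ioo hpt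
    _ = ENNReal.ofReal (M ^ θ * Real.exp (L * φ s)) * ∫⁻ x in Set.Ioo 0 s, (F * G) x :=
        lintegral_const_mul'' _ (hFm.mul hGm)
    _ ≤ ENNReal.ofReal (M ^ θ * Real.exp (L * φ s)) *
        ((∫⁻ x in Set.Ioo 0 s, F x ^ p) ^ (1 / p) * (∫⁻ x in Set.Ioo 0 s, G x ^ q) ^ (1 / q)) := by
        gcongr
    _ ≤ ENNReal.ofReal (M ^ θ * Real.exp (L * φ s)) *
        (ENNReal.ofReal (1 / μ) ^ (1 / p) * ENNReal.ofReal N ^ (1 / q)) := by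
        gcongr
    _ = ENNReal.ofReal (1 / 2 * Real.exp (L * φ s)) := by
        rw [ENNReal.ofReal_rpow_of_nonneg (by positivity) (by positivity),
          ENNReal.ofReal_rpow_of_nonneg (by positivity) (by positivity),
          ← ENNReal.ofReal_mul (by positivity), ← ENNReal.ofReal_mul (by positivity)]
        congr 1
        have : (1 / μ) ^ (1 / p) = 1 / (2 * D) := by
          rw [Real.div_rpow (by norm_num) hμp.le, Real.one_rpow, hμ, ← Real.rpow_mul (by positivity),
            mul_one_div_cancel hp0.ne', Real.rpow_one]
        rw [this]
        calc _ = Real.exp (L * φ s) * (1 / (2 * D)) * D := by rw [hD]; ring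
          _ = _ := by field_simp

/-- A nonnegative subsolution of the homogeneous inequality which tends to zero vanishes. -/
lemma homog (δ E θ : ℝ) (hδ : 0 < δ) (hδ' : δ ≤ 1 / 100) (hE : 0 < E) (hθ₀ : 0 ≤ θ) (hθ₁ : θ < 1)
    (c h W : ℝ → ℝ) (hc : IsFreqEnvelopeLE δ E c) (hW : ∀ s, 0 < s → 1 ≤ W s)
    (hKW : ∀ s, 0 < s → ∫⁻ x in Set.Ioo 0 s, ENNReal.ofReal
      (c x * (((s - x) / s) ^ (-θ) * (x / s) ^ (3 * δ) / x) * W x) ≤ ENNReal.ofReal (1 / 2 * W s))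
    (hh0 : ∀ s, 0 < s → 0 ≤ h s)
    (hhint : LocallyIntegrableOn h (Set.Ioi 0) volume)
    (hlim : ∃ s0 > 0, ∀ s, 0 < s → s ≤ s0 → h s ≤ 1)
    (hK : ∀ s, 0 < s → ENNReal.ofReal (h s) ≤ ∫⁻ x in Set.Ioo 0 s, ENNReal.ofReal
      (c x * (((s - x) / s) ^ (-θ) * (x / s) ^ (3 * δ) / x) * h x)) :
    ∀ s, 0 < s → h s = 0 := by
  obtain ⟨s0, hs0, hb⟩ := hlim
  have hc0 := hc.1
  -- near zero
  have step1 : ∀ n : ℕ, ∀ s, 0 < s → s ≤ s0 → h s ≤ (1/2) ^ n * W s := by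
    intro n
    induction n with
    | zero =>
      intro s hs hss
      simpa using (hb s hs hss).trans (hW s hs)
    | succ n ih =>
      intro s hs hss
      have hWs := hW s hs
      rw [← ENNReal.ofReal_le_ofReal_iff (by positivity)]
      refine (hK s hs).trans ?_
      calc _ ≤ ∫⁻ x in Set.Ioo 0 s, ENNReal.ofReal ((1/2) ^ n) * ENNReal.ofReal
            (c x * (((s - x) / s) ^ (-θ) * (x / s) ^ (3 * δ) / x) * W x) := by
            apply setLIntegral_mono' measurableSet_Ioo
            intro x hx
            have hx0 := hx.1
            have hx1 : 0 < s - x := by linarith [hx.2]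
            rw [← ENNReal.ofReal_mul (by positivity)]
            apply ENNReal.ofReal_le_ofReal
            have hcx := hc0 x hx0
            calc _ ≤ c x * (((s - x) / s) ^ (-θ) * (x / s) ^ (3 * δ) / x) * ((1/2) ^ n * W x) := by
                  apply mul_le_mul_of_nonneg_left (ih x hx0 (by linarith)); positivity
              _ = _ := by ring
        _ = ENNReal.ofReal ((1/2) ^ n) * ∫⁻ x in Set.Ioo 0 s, ENNReal.ofReal
            (c x * (((s - x) / s) ^ (-θ) * (x / s) ^ (3 * δ) / x) * W x) :=
            lintegral_const_mul' _ _ ENNReal.ofReal_ne_top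
        _ ≤ ENNReal.ofReal ((1/2) ^ n) * ENNReal.ofReal (1 / 2 * W s) := by
            gcongr; exact hKW s hs
        _ = _ := by
            rw [← ENNReal.ofReal_mul (by positivity)]; congr 1; ring
  have step2 : ∀ s, 0 < s → s ≤ s0 → h s = 0 := by
    intro s hs hss
    apply le_antisymm _ (hh0 s hs)
    have ht : Filter.Tendsto (fun n : ℕ => (1/2 : ℝ) ^ n * W s) Filter.atTop (nhds (0 * W s)) :=
      (tendsto_pow_atTop_nhds_zero_of_lt_one (by norm_num) (by norm_num)).mul_const _
    rw [zero_mul] at ht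
    exact ge_of_tendsto' ht (fun n => step1 n s hs hss)
  -- L¹ argument
  have step3 : ∀ T, s0 < T → ∀ᵐ s ∂volume, s ∈ Set.Ioo s0 T → h s = 0 := by
    intro T hT
    have hT0 : 0 < T := hs0.trans hT
    set M : ℝ := 2 * Real.sqrt E with hM
    have hMp : 0 < M := by
      have := Real.sqrt_pos.mpr hE
      positivity
    obtain ⟨β, hβ, hβi⟩ := exp_kernel (M * T ^ θ / s0) θ (by positivity) hθ₁
    set A := M * T ^ θ / s0 with hA
    have hAp : 0 < A := by positivity
    set r : ℝ → ENNReal := (Set.Ioi 0).indicator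
      (fun t => ENNReal.ofReal (A * t ^ (-θ) * Real.exp (-(β * t)))) with hr
    set H : ℝ → ENNReal := (Set.Ioo s0 T).indicator
      (fun s => ENNReal.ofReal (h s * Real.exp (-(β * s)))) with hH
    have hhI : IntegrableOn h (Set.Ioo s0 T) := by
      have : IntegrableOn h (Set.Icc s0 T) :=
        hhint.integrableOn_compact_subset (fun x hx => lt_of_lt_of_le hs0 hx.1) isCompact_Icc
      exact this.mono_set Set.Ioo_subset_Icc_self
    have hhm : AEMeasurable h (volume.restrict (Set.Ioo s0 T)) := hhI.aemeasurable
    have hz : H =ᵐ[volume] 0 := by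
      apply l1_zero H r
      · rw [hH, aemeasurable_indicator_iff measurableSet_Ioo]
        fun_prop
      · exact Measurable.indicator (by fun_prop) measurableSet_Ioi
      · rw [hr, lintegral_indicator measurableSet_Ioi]
        exact hβi
      · rw [hH, lintegral_indicator measurableSet_Ioo]
        refine ne_of_lt (lt_of_le_of_lt ?_ hhI.2)
        apply setLIntegral_mono' measurableSet_Ioo
        intro x hx
        have hx0 : 0 < x := hs0.trans hx.1
        have hhx := hh0 x hx0
        rw [← ofReal_norm, Real.norm_of_nonneg hhx]
        apply ENNReal.ofReal_le_ofReal
        have : Real.exp (-(β * x)) ≤ 1 := by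
          rw [Real.exp_le_one_iff]; nlinarith
        nlinarith
      · intro s
        by_cases hsm : s ∈ Set.Ioo s0 T
        swap
        · rw [hH, Set.indicator_of_notMem hsm]; exact zero_le
        have hs : 0 < s := hs0.trans hsm.1
        have hHs : H s = ENNReal.ofReal (Real.exp (-(β * s))) * ENNReal.ofReal (h s) := by
          rw [hH, Set.indicator_of_mem hsm, ← ENNReal.ofReal_mul (by positivity), mul_comm]
        rw [hHs]
        calc _ ≤ ENNReal.ofReal (Real.exp (-(β * s))) * ∫⁻ x in Set.Ioo 0 s, ENNReal.ofReal
              (c x * (((s - x) / s) ^ (-θ) * (x / s) ^ (3 * δ) / x) * h x) := by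
              gcongr; exact hK s hs
          _ = ∫⁻ x in Set.Ioo 0 s, ENNReal.ofReal (Real.exp (-(β * s))) * ENNReal.ofReal
              (c x * (((s - x) / s) ^ (-θ) * (x / s) ^ (3 * δ) / x) * h x) :=
              (lintegral_const_mul' _ _ ENNReal.ofReal_ne_top).symm
          _ ≤ ∫⁻ x in Set.Ioo 0 s, r (s - x) * H x := by
              apply setLIntegral_mono' measurableSet_Ioo
              intro x hx
              have hx0 := hx.1
              have hx1 : 0 < s - x := by linarith [hx.2]
              by_cases hxs : x ≤ s0
              · rw [step2 x hx0 hxs]; simp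
              push Not at hxs
              have hxm : x ∈ Set.Ioo s0 T := ⟨hxs, hx.2.trans hsm.2⟩
              rw [hH, hr, Set.indicator_of_mem hxm, Set.indicator_of_mem (show s - x ∈ Set.Ioi 0 from hx1),
                ← ENNReal.ofReal_mul (by positivity), ← ENNReal.ofReal_mul (by positivity)]
              apply ENNReal.ofReal_le_ofReal
              have hhx := hh0 x hx0
              have hcx := hc0 x hx0
              have hcM : c x ≤ M := env_bound δ E hδ hδ' c hc x hx0
              have e1 : ((s - x) / s) ^ (-θ) ≤ (s - x) ^ (-θ) * T ^ θ := by
                rw [Real.div_rpow hx1.le hs.le, Real.rpow_neg hs.le, div_inv_eq_mul]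
                gcongr
                exact hsm.2.le
              have e2 : (x / s) ^ (3 * δ) ≤ 1 := Real.rpow_le_one (by positivity)
                (by rw [div_le_one hs]; exact hx.2.le) (by positivity)
              have e3 : Real.exp (-(β * s)) = Real.exp (-(β * (s - x))) * Real.exp (-(β * x)) := by
                rw [← Real.exp_add]; congr 1; ring
              have e4 : c x * (((s - x) / s) ^ (-θ) * (x / s) ^ (3 * δ) / x) ≤
                  M * (((s - x) ^ (-θ) * T ^ θ) * 1 / s0) := by
                gcongr
              calc _ ≤ Real.exp (-(β * s)) * (M * (((s - x) ^ (-θ) * T ^ θ) * 1 / s0) * h x) := by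
                    gcongr
                _ = _ := by rw [e3, hA]; ring
          _ ≤ _ := setLIntegral_le_lintegral _ _
    filter_upwards [hz] with s hs hsm
    rw [hH, Set.indicator_of_mem hsm] at hs
    simp only [Pi.zero_apply, ENNReal.ofReal_eq_zero] at hs
    have h1 := hh0 s (hs0.trans hsm.1)
    have h2 := Real.exp_pos (-(β * s))
    by_contra hne
    have : 0 < h s := lt_of_le_of_ne h1 (Ne.symm hne)
    have := mul_pos this h2
    linarith
  intro s hs
  have h3 := step3 (s0 + s) (by linarith)
  have h4 := hK s hs
  have h5 : ∫⁻ x in Set.Ioo 0 s, ENNReal.ofReal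
      (c x * (((s - x) / s) ^ (-θ) * (x / s) ^ (3 * δ) / x) * h x) = 0 := by
    rw [← lintegral_zero (μ := volume.restrict (Set.Ioo 0 s))]
    apply lintegral_congr_ae
    filter_upwards [ae_restrict_mem measurableSet_Ioo, ae_restrict_of_ae h3] with x hx hx3
    have : h x = 0 := by
      by_cases hxs : x ≤ s0
      · exact step2 x hx.1 hxs
      · push Not at hxs
        exact hx3 ⟨hxs, by linarith [hx.2]⟩
    rw [this]; simp
  rw [h5] at h4
  simp only [nonpos_iff_eq_zero, ENNReal.ofReal_eq_zero] at h4
  exact le_antisymm h4 (hh0 s hs)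

/-- Gronwall-type inequality from `s = 0`: if
`f(s) ≤ g(s) + ∫₀^s f(s′) c(s′) ((s−s′)/s)^{−θ} (s′/s)^{3δ₀} ds′/s′`,
`f → 0` as `s → 0⁺` and `g` obeys the envelope fluctuation bound, then `f ≲_{E,θ,δ₀} g`. -/
theorem gronwall_from_zero (δ₀ : ℝ) (hδ₀ : 0 < δ₀) (hδ₀' : δ₀ ≤ 1 / 100)
    (E θ : ℝ) (hE : 0 < E) (hθ₀ : 0 ≤ θ) (hθ₁ : θ < 1) :
    ∃ C > (0 : ℝ), ∀ c f g : ℝ → ℝ,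
      IsFreqEnvelopeLE δ₀ E c →
      (∀ s : ℝ, 0 < s → 0 ≤ f s) →
      (∀ s : ℝ, 0 < s → 0 ≤ g s) →
      LocallyIntegrableOn f (Set.Ioi 0) volume →
      LocallyIntegrableOn g (Set.Ioi 0) volume →
      Filter.Tendsto f (nhdsWithin 0 (Set.Ioi 0)) (nhds 0) →
      (∀ s : ℝ, 0 < s → ∀ s' : ℝ, 0 < s' →
        g s' ≤ max ((s' / s) ^ δ₀) ((s / s') ^ δ₀) * g s) →
      (∀ s : ℝ, 0 < s →
        f s ≤ g s + ∫ s' in Set.Ioo (0 : ℝ) s,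
          f s' * c s' * ((s - s') / s) ^ (-θ) * (s' / s) ^ (3 * δ₀) / s') →
      ∀ s : ℝ, 0 < s → f s ≤ C * g s := by
  obtain ⟨L, hL, hkey⟩ := key δ₀ E θ hδ₀ hδ₀' hE hθ₀ hθ₁
  refine ⟨2 * Real.exp (L * E), by positivity, ?_⟩
  intro c f g hc hf0 hg0 hfi hgi hft hg hfK
  obtain ⟨φ, hφc, hφb, hφk⟩ := hkey c hc
  set W : ℝ → ℝ := fun s => Real.exp (L * φ s) with hWdef
  have hWpos : ∀ s, 0 < W s := fun s => Real.exp_pos _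
  have hW1 : ∀ s, 0 < s → 1 ≤ W s := fun s hs => by
    rw [hWdef]; simp only [Real.one_le_exp_iff]
    have := (hφb s hs).1
    positivity
  have hWE : ∀ s, 0 < s → W s ≤ Real.exp (L * E) := fun s hs => by
    rw [hWdef]; simp only [Real.exp_le_exp]
    have := (hφb s hs).2
    gcongr
  have hc0 := hc.1
  have hWc : ContinuousOn W (Set.Ioi 0) := by rw [hWdef]; fun_prop
  have hgc : ContinuousOn g (Set.Ioi 0) := env_cont δ₀ g hg
  have hcc : ContinuousOn c (Set.Ioi 0) := env_cont δ₀ c hc.2.2.2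
  have gen : ∀ w : ℝ → ℝ, ∀ s, 0 < s → 0 ≤ w s → (∀ x ∈ Set.Ioo 0 s, w x ≤ (s / x) ^ δ₀ * w s) →
      ∫⁻ x in Set.Ioo 0 s, ENNReal.ofReal
        (c x * (((s - x) / s) ^ (-θ) * (x / s) ^ (3 * δ₀) / x) * (w x * W x)) ≤
        ENNReal.ofReal (1 / 2 * (w s * W s)) := by
    intro w s hs hws hw
    calc _ ≤ ∫⁻ x in Set.Ioo 0 s, ENNReal.ofReal (w s) * ENNReal.ofReal
            (c x * (s / x) ^ δ₀ * (((s - x) / s) ^ (-θ) * (x / s) ^ (3 * δ₀) / x) * Real.exp (L * φ x)) := by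
          apply setLIntegral_mono' measurableSet_Ioo
          intro x hx
          have hx0 := hx.1
          have hx1 : 0 < s - x := by linarith [hx.2]
          rw [← ENNReal.ofReal_mul hws]
          apply ENNReal.ofReal_le_ofReal
          have hcx := hc0 x hx0
          have hWx := hWpos x
          calc _ ≤ c x * (((s - x) / s) ^ (-θ) * (x / s) ^ (3 * δ₀) / x) *
                (((s / x) ^ δ₀ * w s) * W x) := by
                apply mul_le_mul_of_nonneg_left _ (by positivity)
                exact mul_le_mul_of_nonneg_right (hw x hx) hWx.le
            _ = _ := by rw [hWdef]; ring
      _ = ENNReal.ofReal (w s) * ∫⁻ x in Set.Ioo 0 s, ENNReal.ofReal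
            (c x * (s / x) ^ δ₀ * (((s - x) / s) ^ (-θ) * (x / s) ^ (3 * δ₀) / x) * Real.exp (L * φ x)) :=
          lintegral_const_mul' _ _ ENNReal.ofReal_ne_top
      _ ≤ ENNReal.ofReal (w s) * ENNReal.ofReal (1 / 2 * Real.exp (L * φ s)) := by
          gcongr; exact hφk s hs
      _ = _ := by
          rw [← ENNReal.ofReal_mul hws]; congr 1; rw [hWdef]; ring
  set G : ℝ → ℝ := fun s => 2 * (g s * W s) with hG
  have hG0 : ∀ s, 0 < s → 0 ≤ G s := fun s hs => by
    have := hg0 s hs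
    have := hWpos s
    simp only [hG]; positivity
  have hGc : ContinuousOn G (Set.Ioi 0) := by rw [hG]; fun_prop
  set h : ℝ → ℝ := fun s => max (f s - G s) 0 with hh
  have hzero : ∀ s, 0 < s → h s = 0 := by
    apply homog δ₀ E θ hδ₀ hδ₀' hE hθ₀ hθ₁ c h W hc hW1
    · intro s hs
      have := gen (fun _ => 1) s hs zero_le_one (fun x hx => by
        rw [mul_one]
        apply Real.one_le_rpow _ hδ₀.le
        rw [one_le_div hx.1]; exact hx.2.le)
      simpa only [one_mul] using this
    · intro s hs; exact le_max_right _ _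
    · have h1 : LocallyIntegrableOn (fun s => f s - G s) (Set.Ioi 0) volume :=
        hfi.sub (hGc.locallyIntegrableOn measurableSet_Ioi)
      intro x hx
      obtain ⟨t, ht, hti⟩ := h1 x hx
      exact ⟨t, ht, hti.pos_part⟩
    · have h1 : ∀ᶠ s in nhdsWithin (0:ℝ) (Set.Ioi 0), f s < 1 := hft.eventually_lt_const one_pos
      obtain ⟨u, hu, hu1⟩ := (mem_nhdsGT_iff_exists_Ioc_subset).1 h1
      refine ⟨u, hu, fun s hs hsu => ?_⟩
      have h2 : f s < 1 := hu1 ⟨hs, hsu⟩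
      have h3 := hG0 s hs
      exact max_le (by linarith) zero_le_one
    · intro s hs
      have hsub : Set.Ioo 0 s ⊆ Set.Ioi 0 := fun x hx => hx.1
      have hGm : AEMeasurable G (volume.restrict (Set.Ioo 0 s)) :=
        (hGc.mono hsub).aemeasurable measurableSet_Ioo
      have hcm : AEMeasurable c (volume.restrict (Set.Ioo 0 s)) :=
        (hcc.mono hsub).aemeasurable measurableSet_Ioo
      set I := ∫⁻ x in Set.Ioo 0 s, ENNReal.ofReal
        (c x * (((s - x) / s) ^ (-θ) * (x / s) ^ (3 * δ₀) / x) * h x) with hI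
      have hgs := hg0 s hs
      have hWs := hW1 s hs
      have k1 : ENNReal.ofReal (∫ s' in Set.Ioo (0 : ℝ) s,
          f s' * c s' * ((s - s') / s) ^ (-θ) * (s' / s) ^ (3 * δ₀) / s') ≤
          ENNReal.ofReal (g s * W s) + I := by
        calc _ ≤ ‖∫ s' in Set.Ioo (0 : ℝ) s,
                f s' * c s' * ((s - s') / s) ^ (-θ) * (s' / s) ^ (3 * δ₀) / s'‖ₑ :=
              Real.ofReal_le_enorm _
          _ ≤ ∫⁻ s' in Set.Ioo (0 : ℝ) s,
                ‖f s' * c s' * ((s - s') / s) ^ (-θ) * (s' / s) ^ (3 * δ₀) / s'‖ₑ :=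
              enorm_integral_le_lintegral_enorm _
          _ ≤ ∫⁻ x in Set.Ioo (0 : ℝ) s,
                (ENNReal.ofReal (c x * (((s - x) / s) ^ (-θ) * (x / s) ^ (3 * δ₀) / x) * G x) +
                ENNReal.ofReal (c x * (((s - x) / s) ^ (-θ) * (x / s) ^ (3 * δ₀) / x) * h x)) := by
              apply setLIntegral_mono' measurableSet_Ioo
              intro x hx
              have hx0 := hx.1
              have hx1 : 0 < s - x := by linarith [hx.2]
              have hcx := hc0 x hx0
              have hfx := hf0 x hx0
              have hGx := hG0 x hx0
              have hhx : 0 ≤ h x := le_max_right _ _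
              have hfh : f x ≤ G x + h x := by
                have : f x - G x ≤ h x := le_max_left _ _
                linarith
              rw [Real.enorm_of_nonneg (by positivity),
                ← ENNReal.ofReal_add (by positivity) (by positivity)]
              apply ENNReal.ofReal_le_ofReal
              calc _ = c x * (((s - x) / s) ^ (-θ) * (x / s) ^ (3 * δ₀) / x) * f x := by ring
                _ ≤ c x * (((s - x) / s) ^ (-θ) * (x / s) ^ (3 * δ₀) / x) * (G x + h x) :=
                    mul_le_mul_of_nonneg_left hfh (by positivity)
                _ = _ := by ring
          _ = (∫⁻ x in Set.Ioo (0 : ℝ) s,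
                ENNReal.ofReal (c x * (((s - x) / s) ^ (-θ) * (x / s) ^ (3 * δ₀) / x) * G x)) + I := by
              apply lintegral_add_left'
              fun_prop
          _ ≤ _ := by
              gcongr
              have := gen (fun x => 2 * g x) s hs (by positivity) (fun x hx => by
                have h1 := hg s hs x hx.1
                have h2 : (x / s) ^ δ₀ ≤ (s / x) ^ δ₀ := by
                  apply Real.rpow_le_rpow (div_nonneg hx.1.le hs.le) _ hδ₀.le
                  have a1 : x / s ≤ 1 := by rw [div_le_one hs]; exact hx.2.le
                  have a2 : 1 ≤ s / x := by rw [one_le_div hx.1]; exact hx.2.le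
                  linarith
                rw [max_eq_right h2] at h1
                linarith)
              calc _ = ∫⁻ x in Set.Ioo 0 s, ENNReal.ofReal
                      (c x * (((s - x) / s) ^ (-θ) * (x / s) ^ (3 * δ₀) / x) * (2 * g x * W x)) := by
                    simp only [hG, mul_assoc]
                _ ≤ _ := this
                _ = _ := by congr 1; ring
      have k2 : ENNReal.ofReal (f s) ≤ ENNReal.ofReal (G s) + I := by
        calc _ ≤ ENNReal.ofReal (g s) + ENNReal.ofReal (∫ s' in Set.Ioo (0 : ℝ) s,
              f s' * c s' * ((s - s') / s) ^ (-θ) * (s' / s) ^ (3 * δ₀) / s') :=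
              (ENNReal.ofReal_le_ofReal (hfK s hs)).trans ENNReal.ofReal_add_le
          _ ≤ ENNReal.ofReal (g s) + (ENNReal.ofReal (g s * W s) + I) := by gcongr
          _ = ENNReal.ofReal (g s + g s * W s) + I := by
              rw [← add_assoc, ← ENNReal.ofReal_add hgs (by positivity)]
          _ ≤ _ := by
              gcongr
              simp only [hG]
              nlinarith
      have k3 : ENNReal.ofReal (h s) = ENNReal.ofReal (f s - G s) := by
        simp only [hh]
        rcases le_total (f s - G s) 0 with h1 | h1
        · rw [max_eq_right h1, ENNReal.ofReal_of_nonpos h1, ENNReal.ofReal_zero]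
        · rw [max_eq_left h1]
      rw [k3, ENNReal.ofReal_sub _ (hG0 s hs)]
      exact tsub_le_iff_left.mpr k2
  intro s hs
  have h1 : f s - G s ≤ h s := le_max_left _ _
  rw [hzero s hs] at h1
  have h2 := hg0 s hs
  have h3 := hWE s hs
  have h4 : G s ≤ 2 * Real.exp (L * E) * g s := by
    simp only [hG]
    nlinarith
  linarith
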